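/- For every ε > 0 there exists n₀ ≥ 1 such that for all n ≥ n₀, all x ∈ ℝ and all y ∈ Iₙ(x), one has 1 − ε ≤ mₙ(y)/mₙ(x) ≤ 1 + ε. -/

import Mathlib

open Filter Topology

/-- Gauss-map orbit of `α`: `α₀ = α`, `αₙ₊₁ = 1 / fract(αₙ)`. -/
noncomputable def cfGauss (α : ℝ) : ℕ → ℝ
  | 0 => α
  | n + 1 => (Int.fract (cfGauss α n))⁻¹

/-- Partial quotients `aₙ` of the continued fraction of `α`. -/
noncomputable def cfA (α : ℝ) (n : ℕ) : ℤ := ⌊cfGauss α n⌋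

/-- Numerators `pₙ` of the convergents of `α`. -/
noncomputable def cfP (α : ℝ) : ℕ → ℤ
  | 0 => cfA α 0
  | 1 => cfA α 1 * cfA α 0 + 1
  | n + 2 => cfA α (n + 2) * cfP α (n + 1) + cfP α n

/-- Denominators `qₙ` of the convergents of `α` (as natural numbers). -/
noncomputable def cfQ (α : ℝ) : ℕ → ℕ
  | 0 => 1
  | 1 => (cfA α 1).toNat
  | n + 2 => (cfA α (n + 2)).toNat * cfQ α (n + 1) + cfQ α n

/-- `gₙ(x) = g^{qₙ}(x) − pₙ`. -/
noncomputable def cfIter (g : ℝ → ℝ) (α : ℝ) (n : ℕ) (x : ℝ) : ℝ :=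
  g^[cfQ α n] x - cfP α n


structure GoodPair (α : ℝ) (q q' : ℕ) (p p' : ℤ) : Prop where
  qpos : 0 < q
  qle : q ≤ q'
  det : (q : ℤ) * p' - q' * p = 1 ∨ (q : ℤ) * p' - q' * p = -1
  opp : (q * α - p) * (q' * α - p') < 0
  lt : |(q' : ℝ) * α - p'| < |(q : ℝ) * α - p|

theorem GoodPair.best {α : ℝ} {q q' : ℕ} {p p' : ℤ} (H : GoodPair α q q' p p')
    (m r : ℤ) (hm : |m| < q') (h0 : ¬ (m = 0 ∧ r = 0)) :
    |(q : ℝ) * α - p| ≤ |(m : ℝ) * α - r| := by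
  obtain ⟨hq, hle, det, opp, hlt⟩ := H
  obtain ⟨u, v, h1, h2⟩ : ∃ u v : ℤ, m = u * q + v * q' ∧ r = u * p + v * p' := by
    rcases det with d | d
    · refine ⟨m * p' - r * q', r * q - m * p, ?_, ?_⟩
      · linear_combination (-m) * d
      · linear_combination (-r) * d
    · refine ⟨-(m * p' - r * q'), -(r * q - m * p), ?_, ?_⟩
      · linear_combination (m) * d
      · linear_combination (r) * d
  have hqz : (0 : ℤ) < q := by exact_mod_cast hq
  have hqz' : (0 : ℤ) < q' := by exact_mod_cast lt_of_lt_of_le hq hle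
  rw [abs_lt] at hm
  have hu : u ≠ 0 := by
    rintro rfl
    have hv : v = 0 := by
      by_contra hv
      rcases lt_or_gt_of_ne hv with hv | hv
      · nlinarith
      · nlinarith
    subst hv
    exact h0 ⟨by simpa using h1, by simpa using h2⟩
  have huv : (0 ≤ u ∧ v ≤ 0) ∨ (u ≤ 0 ∧ 0 ≤ v) := by
    rcases lt_or_gt_of_ne hu with hu | hu
    · right
      refine ⟨hu.le, ?_⟩
      by_contra hv
      push Not at hv
      nlinarith
    · left
      refine ⟨hu.le, ?_⟩
      by_contra hv
      push Not at hv
      nlinarith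
  have e : (m : ℝ) * α - r = u * (q * α - p) + v * (q' * α - p') := by
    rw [h1, h2]; push_cast; ring
  rw [e]
  set d := (q : ℝ) * α - p
  set d' := (q' : ℝ) * α - p'
  have hu1 : (1 : ℝ) ≤ |(u : ℝ)| := by
    exact_mod_cast Int.one_le_abs hu
  have key : |(u : ℝ) * d| ≤ |u * d + v * d'| := by
    have : 0 ≤ (u * d) * (v * d') := by
      have h3 : (u : ℝ) * v ≤ 0 := by
        rcases huv with ⟨a, b⟩ | ⟨a, b⟩
        · exact mul_nonpos_of_nonneg_of_nonpos (by exact_mod_cast a) (by exact_mod_cast b)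
        · exact mul_nonpos_of_nonpos_of_nonneg (by exact_mod_cast a) (by exact_mod_cast b)
      nlinarith
    apply sq_le_sq.mp
    nlinarith [sq_nonneg ((v : ℝ) * d')]
  refine le_trans ?_ key
  rw [abs_mul]
  nlinarith [abs_nonneg d]

section dyn
variable {g : ℝ → ℝ}

theorem iter_add_int (hper : ∀ x, g (x + 1) = g x + 1) (k : ℕ) (x : ℝ) (i : ℤ) :
    g^[k] (x + i) = g^[k] x + i := by
  have hn : ∀ (n : ℕ) x, g (x + n) = g x + n := by
    intro n
    induction n with
    | zero => simp
    | succ n ih => intro x; push_cast; rw [← add_assoc, hper, ih, add_assoc]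
  have hz : ∀ (i : ℤ) x, g (x + i) = g x + i := by
    intro i x
    obtain ⟨n, rfl | rfl⟩ := i.eq_nat_or_neg
    · exact_mod_cast hn n x
    · have := hn n (x + ((-(n : ℤ) : ℤ) : ℝ))
      push_cast at this ⊢
      rw [neg_add_cancel_right] at this
      linarith
  induction k generalizing x with
  | zero => rfl
  | succ k ih => rw [Function.iterate_succ_apply, Function.iterate_succ_apply, hz, ih]

theorem iter_mul (hper : ∀ x, g (x + 1) = g x + 1) (q : ℕ) (i : ℤ) (m : ℕ) (x : ℝ) :
    (fun t => g^[q] t + i)^[m] x = g^[q * m] x + m * i := by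
  induction m with
  | zero => simp
  | succ m ih =>
    rw [Function.iterate_succ_apply', ih]
    have := iter_add_int hper q (g^[q * m] x) (m * i)
    push_cast at this
    simp only [this]
    rw [← Function.iterate_add_apply, Nat.mul_succ, add_comm q]
    push_cast; ring

theorem rot_pos (hmono : StrictMono g) (hper : ∀ x, g (x + 1) = g x + 1) {α : ℝ}
    (hrot : ∀ x : ℝ, Tendsto (fun m : ℕ => (g^[m] x - x) / m) atTop (𝓝 α))
    (q : ℕ) (i : ℤ) (h : 0 < q * α + i) (x : ℝ) : x < g^[q] x + i := by
  rcases Nat.eq_zero_or_pos q with rfl | hq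
  · simpa using h
  by_contra hc
  push Not at hc
  have hG : Monotone (fun t => g^[q] t + (i : ℝ)) := fun a b hab => by
    have := (hmono.monotone.iterate q) hab
    simpa using this
  have hle : ∀ m : ℕ, g^[q * m] x + m * i ≤ x := by
    intro m
    rw [← iter_mul hper]
    induction m with
    | zero => simp
    | succ m ih =>
      rw [Function.iterate_succ_apply']
      exact le_trans (hG ih) hc
  have hq' : (0 : ℝ) < q := by exact_mod_cast hq
  have ht : Tendsto (fun m : ℕ => q * m) atTop atTop :=
    tendsto_id.const_mul_atTop' hq
  have := le_of_tendsto (b := -(i : ℝ) / q) ((hrot x).comp ht) (by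
    filter_upwards [eventually_gt_atTop 0] with m hm
    have hm' : (0 : ℝ) < m := by exact_mod_cast hm
    have := hle m
    simp only [Function.comp]
    push_cast
    rw [div_le_div_iff₀ (by positivity) hq']
    nlinarith)
  rw [le_div_iff₀ hq'] at this
  linarith

theorem rot_neg (hmono : StrictMono g) (hper : ∀ x, g (x + 1) = g x + 1) {α : ℝ}
    (hrot : ∀ x : ℝ, Tendsto (fun m : ℕ => (g^[m] x - x) / m) atTop (𝓝 α))
    (q : ℕ) (i : ℤ) (h : q * α + i < 0) (x : ℝ) : g^[q] x + i < x := by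
  rcases Nat.eq_zero_or_pos q with rfl | hq
  · simpa using h
  by_contra hc
  push Not at hc
  have hG : Monotone (fun t => g^[q] t + (i : ℝ)) := fun a b hab => by
    have := (hmono.monotone.iterate q) hab
    simpa using this
  have hle : ∀ m : ℕ, x ≤ g^[q * m] x + m * i := by
    intro m
    rw [← iter_mul hper]
    induction m with
    | zero => simp
    | succ m ih =>
      rw [Function.iterate_succ_apply']
      exact le_trans hc (hG ih)
  have hq' : (0 : ℝ) < q := by exact_mod_cast hq
  have ht : Tendsto (fun m : ℕ => q * m) atTop atTop :=
    tendsto_id.const_mul_atTop' hq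
  have := ge_of_tendsto (b := -(i : ℝ) / q) ((hrot x).comp ht) (by
    filter_upwards [eventually_gt_atTop 0] with m hm
    have hm' : (0 : ℝ) < m := by exact_mod_cast hm
    have := hle m
    simp only [Function.comp]
    push_cast
    rw [div_le_div_iff₀ hq' (by positivity)]
    nlinarith)
  rw [div_le_iff₀ hq'] at this
  linarith

theorem ord_lt (hmono : StrictMono g) (hper : ∀ x, g (x + 1) = g x + 1) {α : ℝ}
    (hrot : ∀ x : ℝ, Tendsto (fun m : ℕ => (g^[m] x - x) / m) atTop (𝓝 α))
    {a b : ℕ} {i j : ℤ} (h : a * α + i < b * α + j) (x : ℝ) :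
    g^[a] x + i < g^[b] x + j := by
  rcases le_total a b with hab | hab
  · obtain ⟨c, rfl⟩ := Nat.exists_eq_add_of_le hab
    have := rot_pos hmono hper hrot c (j - i) (by push_cast at h ⊢; linarith) (g^[a] x)
    rw [← Function.iterate_add_apply, add_comm c] at this
    push_cast at this
    linarith
  · obtain ⟨c, rfl⟩ := Nat.exists_eq_add_of_le hab
    have := rot_neg hmono hper hrot c (i - j) (by push_cast at h ⊢; linarith) (g^[b] x)
    rw [← Function.iterate_add_apply, add_comm c] at this
    push_cast at this
    linarith

theorem ord_le (hmono : StrictMono g) (hper : ∀ x, g (x + 1) = g x + 1) {α : ℝ}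
    (hα : Irrational α)
    (hrot : ∀ x : ℝ, Tendsto (fun m : ℕ => (g^[m] x - x) / m) atTop (𝓝 α))
    {a b : ℕ} {i j : ℤ} (h : a * α + i ≤ b * α + j) (x : ℝ) :
    g^[a] x + i ≤ g^[b] x + j := by
  rcases h.lt_or_eq with h | h
  · exact (ord_lt hmono hper hrot h x).le
  · have hab : a = b := by
      by_contra hab
      apply hα
      refine ⟨(j - i) / (a - b), ?_⟩
      have : (a : ℝ) - b ≠ 0 := sub_ne_zero.mpr (by exact_mod_cast hab)
      push_cast
      rw [div_eq_iff this]
      linarith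
    subst hab
    linarith

/-- Disjointness. -/
theorem disj (hmono : StrictMono g) (hper : ∀ x, g (x + 1) = g x + 1) {α : ℝ}
    (hα : Irrational α)
    (hrot : ∀ x : ℝ, Tendsto (fun m : ℕ => (g^[m] x - x) / m) atTop (𝓝 α))
    {q q' : ℕ} {p p' : ℤ} (H : GoodPair α q q' p p') (x z : ℝ) (k l : ℕ) (i j : ℤ)
    (hk : k < q') (hl : l < q')
    (h1 : z + i ∈ Set.uIoc (g^[k] x) (g^[k] (g^[q] x - p)))
    (h2 : z + j ∈ Set.uIoc (g^[l] x) (g^[l] (g^[q] x - p))) : k = l ∧ i = j := by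
  by_contra hne
  have hb := H.best ((k : ℤ) - l) (i - j) (by rw [abs_lt]; omega) (by
    rintro ⟨a, b⟩; apply hne; omega)
  have e : ∀ k, g^[k] (g^[q] x - p) = g^[q + k] x - p := by
    intro k
    have := iter_add_int hper k (g^[q] x) (-p)
    push_cast at this
    rw [sub_eq_add_neg, this, add_comm q, Function.iterate_add_apply]; ring
  rw [e] at h1 h2
  push_cast at hb
  rw [Set.mem_uIoc] at h1 h2
  have L := fun {a b : ℕ} {i j : ℤ} (h : a * α + i ≤ b * α + j) =>
    ord_le hmono hper hα hrot h x
  have hd0 : (q : ℝ) * α - p ≠ 0 := fun h => by have := H.opp; rw [h] at this; simp at this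
  rcases lt_or_gt_of_ne hd0 with hd | hd
  · have s : ∀ k, g^[q + k] x - p ≤ g^[k] x := by
      intro k
      have := L (a := q + k) (b := k) (i := -p) (j := 0) (by push_cast; linarith)
      push_cast at this; linarith
    have s1 := s k
    have s2 := s l
    have h1' : g^[q + k] x - p < z + i ∧ z + i ≤ g^[k] x := by
      rcases h1 with h | h
      · exfalso; linarith
      · exact h
    have h2' : g^[q + l] x - p < z + j ∧ z + j ≤ g^[l] x := by
      rcases h2 with h | h
      · exfalso; linarith
      · exact h
    rw [abs_of_neg hd] at hb
    rcases le_abs.mp hb with hb | hb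
    · have := L (a := l) (b := q + k) (i := -j) (j := -p - i) (by push_cast; linarith)
      push_cast at this; linarith
    · have := L (a := k) (b := q + l) (i := -i) (j := -p - j) (by push_cast; linarith)
      push_cast at this; linarith
  · have s : ∀ k, g^[k] x ≤ g^[q + k] x - p := by
      intro k
      have := L (a := k) (b := q + k) (i := 0) (j := -p) (by push_cast; linarith)
      push_cast at this; linarith
    have s1 := s k
    have s2 := s l
    have h1' : g^[k] x < z + i ∧ z + i ≤ g^[q + k] x - p := by
      rcases h1 with h | h
      · exact h
      · exfalso; linarith
    have h2' : g^[l] x < z + j ∧ z + j ≤ g^[q + l] x - p := by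
      rcases h2 with h | h
      · exact h
      · exfalso; linarith
    rw [abs_of_pos hd] at hb
    rcases le_abs.mp hb with hb | hb
    · have := L (a := q + l) (b := k) (i := -p - j) (j := - i) (by push_cast; linarith)
      push_cast at this; linarith
    · have := L (a := q + k) (b := l) (i := -p - i) (j := -j) (by push_cast; linarith)
      push_cast at this; linarith

/-- Covering. -/
theorem cover (hmono : StrictMono g) (hper : ∀ x, g (x + 1) = g x + 1) {α : ℝ}
    (hrot : ∀ x : ℝ, Tendsto (fun m : ℕ => (g^[m] x - x) / m) atTop (𝓝 α))
    {q q' : ℕ} {p p' : ℤ} (H : GoodPair α q q' p p') (x z : ℝ) :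
    ∃ k < q + q', ∃ i : ℤ, z + i ∈ Set.uIoc (g^[k] x) (g^[k] (g^[q] x - p)) := by
  have e : ∀ k, g^[k] (g^[q] x - p) = g^[q + k] x - p := by
    intro k
    have := iter_add_int hper k (g^[q] x) (-p)
    push_cast at this
    rw [sub_eq_add_neg, this, add_comm q, Function.iterate_add_apply]; ring
  have L := fun {a b : ℕ} {i j : ℤ} (h : a * α + i < b * α + j) =>
    ord_lt hmono hper hrot h x
  have hd0 : (q : ℝ) * α - p ≠ 0 := fun h => by have := H.opp; rw [h] at this; simp at this
  have hqq : 0 < q := H.qpos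
  have hopp := H.opp
  have hlt := H.lt
  have hN : (Finset.range (q + q')).Nonempty := ⟨0, by simp; omega⟩
  rcases lt_or_gt_of_ne hd0 with hd | hd
  · obtain ⟨k, hk, hmin⟩ := Finset.exists_min_image (Finset.range (q + q'))
      (fun k => g^[k] x + ⌈z - g^[k] x⌉) hN
    have hd' : 0 < (q' : ℝ) * α - p' := by nlinarith
    rw [abs_of_neg hd, abs_of_pos hd'] at hlt
    rw [Finset.mem_range] at hk
    set i := ⌈z - g^[k] x⌉ with hi
    have hzi : z ≤ g^[k] x + i := by have := Int.le_ceil (z - g^[k] x); rw [← hi] at this; linarith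
    have hm : ∀ (l : ℕ) (j : ℤ), l < q + q' → g^[l] x + j < g^[k] x + i → g^[l] x + j < z := by
      intro l j hl h
      by_contra hc
      push Not at hc
      have h1 := hmin l (by simpa using hl)
      have h2 : ⌈z - g^[l] x⌉ ≤ j := Int.ceil_le.mpr (by linarith)
      have h3 : ((⌈z - g^[l] x⌉ : ℤ) : ℝ) ≤ j := by exact_mod_cast h2
      linarith
    refine ⟨k, hk, -i, ?_⟩
    rw [e, Set.mem_uIoc]
    right
    refine ⟨?_, by push_cast; linarith⟩
    by_cases hkq : k < q'
    · have := hm (q + k) (i - p) (by omega) (L (by push_cast; linarith))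
      push_cast at this ⊢; linarith
    · obtain ⟨c, rfl⟩ := Nat.exists_eq_add_of_le (not_lt.mp hkq)
      have h1 := hm c (i + p') (by omega) (L (by push_cast; linarith))
      have h2 := L (a := q + (q' + c)) (b := c) (i := i - p) (j := i + p') (by push_cast; linarith)
      push_cast at h1 h2 ⊢; linarith
  · obtain ⟨k, hk, hmin⟩ := Finset.exists_max_image (Finset.range (q + q'))
      (fun k => g^[k] x + ((⌈z - g^[k] x⌉ - 1 : ℤ) : ℝ)) hN
    have hd' : (q' : ℝ) * α - p' < 0 := by nlinarith
    rw [abs_of_pos hd, abs_of_neg hd'] at hlt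
    rw [Finset.mem_range] at hk
    set i := ⌈z - g^[k] x⌉ - 1 with hi
    have hzi : g^[k] x + i < z := by
      have := Int.ceil_lt_add_one (z - g^[k] x)
      rw [hi]; push_cast; linarith
    have hm : ∀ (l : ℕ) (j : ℤ), l < q + q' → g^[k] x + i < g^[l] x + j → z ≤ g^[l] x + j := by
      intro l j hl h
      by_contra hc
      push Not at hc
      have h1 := hmin l (by simpa using hl)
      have h2 : j < ⌈z - g^[l] x⌉ := Int.lt_ceil.mpr (by linarith)
      have h3 : (j : ℝ) ≤ ((⌈z - g^[l] x⌉ - 1 : ℤ) : ℝ) := by exact_mod_cast Int.le_sub_one_of_lt h2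
      linarith
    refine ⟨k, hk, -i, ?_⟩
    rw [e, Set.mem_uIoc]
    left
    refine ⟨by push_cast; linarith, ?_⟩
    by_cases hkq : k < q'
    · have := hm (q + k) (i - p) (by omega) (L (by push_cast; linarith))
      push_cast at this ⊢; linarith
    · obtain ⟨c, rfl⟩ := Nat.exists_eq_add_of_le (not_lt.mp hkq)
      have h1 := hm c (i + p') (by omega) (L (by push_cast; linarith))
      have h2 := L (b := q + (q' + c)) (a := c) (j := i - p) (i := i + p') (by push_cast; linarith)
      push_cast at h1 h2 ⊢; linarith

end dyn

section integrals
open MeasureTheory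

theorem lint_fold (F : ℝ → ENNReal) :
    ∫⁻ x, F x = ∑' i : ℤ, ∫⁻ x in Set.Ioc (0 : ℝ) 1, F (x + i) := by
  have h : ∀ i : ℤ, ∫⁻ x in Set.Ioc ((0 : ℝ) + i) (0 + i + 1), F x
      = ∫⁻ x in Set.Ioc (0 : ℝ) 1, F (x + i) := by
    intro i
    rw [← lintegral_indicator measurableSet_Ioc, ← lintegral_indicator measurableSet_Ioc,
      ← lintegral_add_right_eq_self _ (i : ℝ)]
    congr 1
    ext x
    simp only [Set.indicator, Set.mem_Ioc]
    congr 1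
    apply propext
    constructor <;> rintro ⟨h1, h2⟩ <;> constructor <;> linarith
  rw [← setLIntegral_univ, ← iUnion_Ioc_add_intCast (0 : ℝ),
    lintegral_iUnion (fun i => measurableSet_Ioc) (Set.pairwise_disjoint_Ioc_add_intCast (0 : ℝ))]
  exact tsum_congr h

theorem abs_int_eq {h : ℝ → ℝ} (hc : Continuous h) (h0 : ∀ x, 0 ≤ h x) (a b : ℝ) :
    ENNReal.ofReal |∫ t in a..b, h t| = ∫⁻ t in Set.uIoc a b, ENNReal.ofReal (h t) := by
  rw [intervalIntegral.abs_intervalIntegral_eq, abs_of_nonneg (integral_nonneg h0),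
    ofReal_integral_eq_lintegral_ofReal]
  · exact (intervalIntegrable_iff.mp (hc.intervalIntegrable a b))
  · exact Filter.Eventually.of_forall h0

theorem sum_abs_int {h : ℝ → ℝ} (hc : Continuous h) (h0 : ∀ x, 0 ≤ h x)
    (hp : ∀ x, h (x + 1) = h x) (N : ℕ) (a b : ℕ → ℝ) :
    ENNReal.ofReal (∑ k ∈ Finset.range N, |∫ t in a k..b k, h t|)
      = ∫⁻ x in Set.Ioc (0 : ℝ) 1, ∑' i : ℤ, ∑ k ∈ Finset.range N,
        (Set.uIoc (a k) (b k)).indicator (fun _ => ENNReal.ofReal (h x)) (x + i) := by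
  have hp' : ∀ (i : ℤ) x, h (x + i) = h x := by
    intro i x
    have := (show Function.Periodic h 1 from hp).int_mul i x
    simpa using this
  have hm : Measurable (fun x => ENNReal.ofReal (h x)) := hc.measurable.ennreal_ofReal
  rw [ENNReal.ofReal_sum_of_nonneg (fun _ _ => abs_nonneg _)]
  simp_rw [abs_int_eq hc h0]
  have : ∀ k, ∫⁻ t in Set.uIoc (a k) (b k), ENNReal.ofReal (h t)
      = ∫⁻ t, (Set.uIoc (a k) (b k)).indicator (fun t => ENNReal.ofReal (h t)) t :=
    fun k => (lintegral_indicator measurableSet_uIoc _).symm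
  simp_rw [this]
  rw [← lintegral_finsetSum _ (fun k _ => hm.indicator measurableSet_uIoc), lint_fold,
    ← lintegral_tsum]
  · congr 1
    ext x
    congr 1
    ext i
    congr 1
    ext k
    simp only [Set.indicator, hp']
  · intro i
    apply Measurable.aemeasurable
    apply Finset.measurable_sum
    intro k _
    exact (hm.indicator measurableSet_uIoc).comp (measurable_add_const _)

theorem int01_eq {h : ℝ → ℝ} (hc : Continuous h) (h0 : ∀ x, 0 ≤ h x) :
    ENNReal.ofReal (∫ t in (0 : ℝ)..1, h t) = ∫⁻ x in Set.Ioc (0 : ℝ) 1, ENNReal.ofReal (h x) := by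
  have := abs_int_eq hc h0 0 1
  rwa [Set.uIoc_of_le zero_le_one,
    abs_of_nonneg (intervalIntegral.integral_nonneg zero_le_one (fun _ _ => h0 _))] at this

theorem sum_int_le {h : ℝ → ℝ} (hc : Continuous h) (h0 : ∀ x, 0 ≤ h x)
    (hp : ∀ x, h (x + 1) = h x) (N : ℕ) (a b : ℕ → ℝ)
    (hd : ∀ z : ℝ, ∀ k l : ℕ, ∀ i j : ℤ, k < N → l < N → z + i ∈ Set.uIoc (a k) (b k) →
      z + j ∈ Set.uIoc (a l) (b l) → k = l ∧ i = j) :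
    ∑ k ∈ Finset.range N, |∫ t in a k..b k, h t| ≤ ∫ t in (0 : ℝ)..1, h t := by
  rw [← ENNReal.ofReal_le_ofReal_iff
    (intervalIntegral.integral_nonneg zero_le_one (fun _ _ => h0 _)),
    sum_abs_int hc h0 hp, int01_eq hc h0]
  apply lintegral_mono
  intro x
  dsimp only
  by_cases hx : ∃ k < N, ∃ i : ℤ, x + i ∈ Set.uIoc (a k) (b k)
  · obtain ⟨k, hk, i, hki⟩ := hx
    rw [tsum_eq_single i, Finset.sum_eq_single k]
    · exact Set.indicator_le_self' (fun _ _ => zero_le) _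
    · intro l hl hlk
      apply Set.indicator_of_notMem
      intro hmem
      exact hlk (hd x l k i i (by simpa using hl) hk hmem hki).1
    · intro h; exact absurd (Finset.mem_range.mpr hk) h
    · intro j hj
      apply Finset.sum_eq_zero
      intro l hl
      apply Set.indicator_of_notMem
      intro hmem
      exact hj (hd x l k j i (by simpa using hl) hk hmem hki).2
  · push Not at hx
    have : ∀ i : ℤ, ∑ k ∈ Finset.range N,
        (Set.uIoc (a k) (b k)).indicator (fun _ => ENNReal.ofReal (h x)) (x + i) = 0 := by
      intro i
      apply Finset.sum_eq_zero
      intro l hl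
      exact Set.indicator_of_notMem (hx l (by simpa using hl) i) _
    simp [this]

theorem le_sum_int {h : ℝ → ℝ} (hc : Continuous h) (h0 : ∀ x, 0 ≤ h x)
    (hp : ∀ x, h (x + 1) = h x) (N : ℕ) (a b : ℕ → ℝ)
    (hd : ∀ z : ℝ, ∃ k < N, ∃ i : ℤ, z + i ∈ Set.uIoc (a k) (b k)) :
    ∫ t in (0 : ℝ)..1, h t ≤ ∑ k ∈ Finset.range N, |∫ t in a k..b k, h t| := by
  rw [← ENNReal.ofReal_le_ofReal_iff (Finset.sum_nonneg (fun _ _ => abs_nonneg _)),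
    sum_abs_int hc h0 hp, int01_eq hc h0]
  apply lintegral_mono
  intro x
  dsimp only
  obtain ⟨k, hk, i, hki⟩ := hd x
  refine le_trans ?_ (ENNReal.le_tsum i)
  refine le_trans ?_ (Finset.single_le_sum (fun _ _ => zero_le) (Finset.mem_range.mpr hk))
  rw [Set.indicator_of_mem hki]

end integrals

theorem cf_gauss_irr {α : ℝ} (hα : Irrational α) (n : ℕ) : Irrational (cfGauss α n) := by
  induction n with
  | zero => exact hα
  | succ n ih =>
    rw [cfGauss]
    apply Irrational.inv
    rw [Int.fract]
    exact ih.sub_intCast _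

theorem cf_gauss_gt {α : ℝ} (hα : Irrational α) (n : ℕ) : 1 < cfGauss α (n + 1) := by
  rw [cfGauss]
  have h1 : Int.fract (cfGauss α n) ≠ 0 := by
    have := cf_gauss_irr hα (n + 1)
    rw [cfGauss] at this
    intro h; rw [h] at this
    simp at this
  exact (one_lt_inv₀ (lt_of_le_of_ne (Int.fract_nonneg _) h1.symm)).mpr (Int.fract_lt_one _)

theorem cf_a_pos {α : ℝ} (hα : Irrational α) (n : ℕ) : 1 ≤ cfA α (n + 1) := by
  rw [cfA, Int.le_floor]
  exact_mod_cast (cf_gauss_gt hα n).le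

theorem cf_gauss_rec (α : ℝ) (n : ℕ) :
    cfGauss α n = cfA α n + (cfGauss α (n + 1))⁻¹ := by
  rw [cfGauss, inv_inv, cfA, Int.floor_add_fract]

theorem cf_delta {α : ℝ} (hα : Irrational α) (n : ℕ) :
    ((cfQ α (n + 1) : ℝ) * α - cfP α (n + 1)) * cfGauss α (n + 2)
      = - ((cfQ α n : ℝ) * α - cfP α n) := by
  have pos : ∀ n, 0 < cfGauss α (n + 1) := fun n => by linarith [cf_gauss_gt hα n]
  have ha : ∀ n, ((cfA α (n + 1)).toNat : ℝ) = cfA α (n + 1) := by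
    intro n
    have : ((cfA α (n + 1)).toNat : ℤ) = cfA α (n + 1) :=
      Int.toNat_of_nonneg (by linarith [cf_a_pos hα n])
    exact_mod_cast this
  induction n with
  | zero =>
    have h0 := cf_gauss_rec α 0
    have h1 := cf_gauss_rec α 1
    have e0 : cfGauss α 0 = α := rfl
    rw [e0] at h0
    simp only [cfQ, cfP, zero_add]
    rw [ha 0]
    have p1 := pos 0
    have p2 := pos 1
    simp only [zero_add, Nat.reduceAdd] at *
    have h2 : (cfA α 1 : ℝ) = cfGauss α 1 - (cfGauss α 2)⁻¹ := by linarith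
    have h3 : α - cfA α 0 = (cfGauss α 1)⁻¹ := by linarith
    push_cast
    have : (cfA α 1 : ℝ) * α - (cfA α 1 * cfA α 0 + 1) = cfA α 1 * (α - cfA α 0) - 1 := by ring
    rw [this, one_mul, h3, h2]
    field_simp
    ring
  | succ n ih =>
    have h1 := cf_gauss_rec α (n + 2)
    have p2 := pos (n + 2)
    have h2 : (cfA α (n + 2) : ℝ) = cfGauss α (n + 2) - (cfGauss α (n + 3))⁻¹ := by linarith
    have e1 : (cfQ α (n + 1 + 1) : ℝ) = cfA α (n + 2) * cfQ α (n + 1) + cfQ α n := by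
      rw [← ha (n + 1)]; simp only [cfQ]; push_cast; rfl
    have e2 : (cfP α (n + 1 + 1) : ℝ) = cfA α (n + 2) * cfP α (n + 1) + cfP α n := by
      simp only [cfP]; push_cast; rfl
    rw [e1, e2, h2]
    have : cfGauss α (n + 1 + 2) = cfGauss α (n + 3) := rfl
    rw [this]
    have p3 : cfGauss α (n + 3) ≠ 0 := p2.ne'
    have : (cfGauss α (n + 3))⁻¹ * cfGauss α (n + 3) = 1 := inv_mul_cancel₀ p3
    linear_combination (cfGauss α (n + 3)) * ih -
      ((cfQ α (n + 1) : ℝ) * α - cfP α (n + 1)) * this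

theorem cf_q_pos {α : ℝ} (hα : Irrational α) (n : ℕ) : 0 < cfQ α n := by
  have ha : ∀ n, 1 ≤ (cfA α (n + 1)).toNat := by
    intro n
    have := cf_a_pos hα n
    omega
  induction n using Nat.strong_induction_on with
  | _ n ih =>
    match n with
    | 0 => simp [cfQ]
    | 1 => simp only [cfQ]; exact ha 0
    | n + 2 =>
      simp only [cfQ]
      have := ih n (by omega)
      omega

theorem cf_q_add {α : ℝ} (hα : Irrational α) (n : ℕ) :
    cfQ α (n + 1) + cfQ α n ≤ cfQ α (n + 2) := by
  have : 1 ≤ (cfA α (n + 2)).toNat := by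
    have : 1 ≤ cfA α (n + 2) := cf_a_pos hα (n + 1)
    omega
  simp only [cfQ]
  nlinarith [cf_q_pos hα (n + 1)]

theorem cf_good {α : ℝ} (hα : Irrational α) (n : ℕ) :
    GoodPair α (cfQ α n) (cfQ α (n + 1)) (cfP α n) (cfP α (n + 1)) := by
  have haz : ∀ n, ((cfA α (n + 1)).toNat : ℤ) = cfA α (n + 1) := fun n =>
      Int.toNat_of_nonneg (by linarith [cf_a_pos hα n])
  have hd := cf_delta hα n
  have hx := cf_gauss_gt hα (n + 1)
  have hne : (cfQ α (n + 1) : ℝ) * α - cfP α (n + 1) ≠ 0 := by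
    have hq := cf_q_pos hα (n + 1)
    have := (hα.natCast_mul hq.ne').sub_intCast (cfP α (n + 1))
    exact this.ne_zero
  set d := (cfQ α n : ℝ) * α - cfP α n
  set d' := (cfQ α (n + 1) : ℝ) * α - cfP α (n + 1)
  have hx' : 1 < cfGauss α (n + 2) := hx
  refine ⟨cf_q_pos hα n, ?_, ?_, ?_, ?_⟩
  · cases n with
    | zero =>
      have := cf_q_pos hα 1
      simp only [cfQ] at this ⊢
      exact this
    | succ n => have := cf_q_add hα n; show cfQ α (n + 1) ≤ cfQ α (n + 2); omega
  · clear hd hx hne d d' hx'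
    induction n with
    | zero =>
      left
      simp only [cfQ, cfP, haz]
      push_cast; ring
    | succ n ih =>
      have e1 : (cfQ α (n + 1 + 1) : ℤ) = cfA α (n + 2) * cfQ α (n + 1) + cfQ α n := by
        rw [← haz (n + 1)]; simp only [cfQ]; push_cast; rfl
      have e2 : (cfP α (n + 1 + 1)) = cfA α (n + 2) * cfP α (n + 1) + cfP α n := by
        simp only [cfP]
      rw [e1, e2]
      rcases ih with ih | ih
      · right; linear_combination -ih
      · left; linear_combination -ih
  · have : d = - (d' * cfGauss α (n + 2)) := by linarith
    show d * d' < 0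
    rw [this]
    have : 0 < d' ^ 2 := by positivity
    nlinarith
  · have : d = - (d' * cfGauss α (n + 2)) := by linarith
    show |d'| < |d|
    rw [this, abs_neg, abs_mul, abs_of_pos (show 0 < cfGauss α (n + 2) by linarith)]
    have : 0 < |d'| := abs_pos.mpr hne
    nlinarith

structure C1P (φ η : ℝ → ℝ) : Prop where
  der : ∀ x, HasDerivAt φ (η x) x
  cont : Continuous η
  per : ∀ x, φ (x + 1) = φ x
  per' : ∀ x, η (x + 1) = η x

noncomputable def varV (η : ℝ → ℝ) : ℝ := ∫ t in (0 : ℝ)..1, |η t|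

theorem varV_nonneg (η : ℝ → ℝ) : 0 ≤ varV η :=
  intervalIntegral.integral_nonneg zero_le_one (fun _ _ => abs_nonneg _)

theorem C1P.diff {φ η : ℝ → ℝ} (H : C1P φ η) {a b y z : ℝ} (hy : y ∈ Set.uIcc a b)
    (hz : z ∈ Set.uIcc a b) : |φ y - φ z| ≤ abs (∫ t in a..b, |η t|) := by
  have h1 : φ y - φ z = ∫ t in z..y, η t :=
    (intervalIntegral.integral_eq_sub_of_hasDerivAt (fun x _ => H.der x)
      (H.cont.intervalIntegrable _ _)).symm
  rw [h1]
  have h2 := intervalIntegral.norm_integral_le_abs_integral_norm (f := η) (a := z) (b := y)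
    (μ := MeasureTheory.volume)
  simp only [Real.norm_eq_abs] at h2
  refine h2.trans ?_
  apply intervalIntegral.abs_integral_mono_interval
  · rw [Set.uIoc, Set.uIoc]
    have := Set.uIcc_subset_uIcc hz hy
    rw [Set.uIcc, Set.uIcc, Set.Icc_subset_Icc_iff (by simp)] at this
    exact Set.Ioc_subset_Ioc this.1 this.2
  · exact Filter.Eventually.of_forall (fun _ => abs_nonneg _)
  · exact (H.cont.abs).intervalIntegrable _ _

theorem C1P.perz {φ η : ℝ → ℝ} (H : C1P φ η) (x : ℝ) (i : ℤ) : φ (x + i) = φ x := by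
  have := (show Function.Periodic φ 1 from H.per).int_mul i x
  simpa using this

structure Setup (g φ0 η0 : ℝ → ℝ) (α : ℝ) (q : ℕ → ℕ) (p : ℕ → ℤ) : Prop where
  mono : StrictMono g
  per : ∀ x, g (x + 1) = g x + 1
  irr : Irrational α
  rot : ∀ x : ℝ, Tendsto (fun m : ℕ => (g^[m] x - x) / m) atTop (𝓝 α)
  good : ∀ n, GoodPair α (q n) (q (n + 1)) (p n) (p (n + 1))
  qadd : ∀ n, q (n + 1) + q n ≤ q (n + 2)
  der : ∀ x, HasDerivAt g (Real.exp (φ0 x)) x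
  c1 : C1P φ0 η0

namespace Setup
variable {g φ0 η0 : ℝ → ℝ} {α : ℝ} {q : ℕ → ℕ} {p : ℕ → ℤ}

theorem comm (S : Setup g φ0 η0 α q p) (n k : ℕ) (x : ℝ) :
    g^[k] (g^[q n] x - p n) = g^[q n] (g^[k] x) - p n := by
  have := iter_add_int S.per k (g^[q n] x) (-(p n))
  push_cast at this
  rw [sub_eq_add_neg, this, ← Function.iterate_add_apply, add_comm k, Function.iterate_add_apply]
  ring

theorem sum_le (S : Setup g φ0 η0 α q p) {h : ℝ → ℝ} (hc : Continuous h) (h0 : ∀ x, 0 ≤ h x)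
    (hp : ∀ x, h (x + 1) = h x) (n : ℕ) (x : ℝ) :
    ∑ k ∈ Finset.range (q (n + 1)), |∫ t in g^[k] x..g^[k] (g^[q n] x - p n), h t|
      ≤ ∫ t in (0 : ℝ)..1, h t := by
  apply sum_int_le hc h0 hp
  intro z k l i j hk hl h1 h2
  exact disj S.mono S.per S.irr S.rot (S.good n) x z k l i j hk hl h1 h2

theorem le_sum (S : Setup g φ0 η0 α q p) {h : ℝ → ℝ} (hc : Continuous h) (h0 : ∀ x, 0 ≤ h x)
    (hp : ∀ x, h (x + 1) = h x) (n : ℕ) (x : ℝ) :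
    ∫ t in (0 : ℝ)..1, h t ≤
    ∑ k ∈ Finset.range (q n + q (n + 1)), |∫ t in g^[k] x..g^[k] (g^[q n] x - p n), h t| := by
  apply le_sum_int hc h0 hp
  intro z
  exact cover S.mono S.per S.rot (S.good n) x z

theorem sum_le2 (S : Setup g φ0 η0 α q p) {h : ℝ → ℝ} (hc : Continuous h) (h0 : ∀ x, 0 ≤ h x)
    (hp : ∀ x, h (x + 1) = h x) (n : ℕ) (x : ℝ) :
    ∑ k ∈ Finset.range (q n + q (n + 1)), |∫ t in g^[k] x..g^[k] (g^[q n] x - p n), h t|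
      ≤ 2 * ∫ t in (0 : ℝ)..1, h t := by
  rw [add_comm (q n), Finset.sum_range_add]
  have h1 := S.sum_le hc h0 hp n x
  have h2 := S.sum_le hc h0 hp n (g^[q (n + 1)] x)
  have h3 : ∑ k ∈ Finset.range (q n),
      |∫ t in g^[q (n + 1) + k] x..g^[q (n + 1) + k] (g^[q n] x - p n), h t|
      ≤ ∑ k ∈ Finset.range (q (n + 1)), |∫ t in g^[k] (g^[q (n + 1)] x)..
        g^[k] (g^[q n] (g^[q (n + 1)] x) - p n), h t| := by
    refine le_trans (le_of_eq ?_) (Finset.sum_le_sum_of_subset_of_nonneg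
      (Finset.range_mono (S.good n).qle) (fun _ _ _ => abs_nonneg _))
    apply Finset.sum_congr rfl
    intro k _
    rw [add_comm _ k, Function.iterate_add_apply, Function.iterate_add_apply, S.comm]
  linarith

theorem iter_mem (S : Setup g φ0 η0 α q p) {a b y : ℝ} (k : ℕ) (hy : y ∈ Set.uIcc a b) :
    g^[k] y ∈ Set.uIcc (g^[k] a) (g^[k] b) := by
  have hm := S.mono.monotone.iterate k
  rw [Set.mem_uIcc] at hy ⊢
  rcases hy with ⟨h1, h2⟩ | ⟨h1, h2⟩
  · exact Or.inl ⟨hm h1, hm h2⟩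
  · exact Or.inr ⟨hm h1, hm h2⟩

theorem dist (S : Setup g φ0 η0 α q p) {φ η : ℝ → ℝ} (H : C1P φ η) (n : ℕ) {x y z : ℝ}
    (hy : y ∈ Set.uIcc x (g^[q n] x - p n)) (hz : z ∈ Set.uIcc x (g^[q n] x - p n))
    {k : ℕ} (hk : k ≤ q n + q (n + 1)) :
    |birkhoffSum g φ k y - birkhoffSum g φ k z| ≤ 2 * varV η := by
  rw [birkhoffSum, birkhoffSum, ← Finset.sum_sub_distrib]
  refine (Finset.abs_sum_le_sum_abs _ _).trans ?_
  refine le_trans ?_ (S.sum_le2 H.cont.abs (fun _ => abs_nonneg _)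
    (fun x => by rw [H.per']) n x)
  refine le_trans (Finset.sum_le_sum (fun j _ => H.diff (S.iter_mem j hy) (S.iter_mem j hz))) ?_
  exact Finset.sum_le_sum_of_subset_of_nonneg (Finset.range_mono hk) (fun _ _ _ => abs_nonneg _)

theorem bs_per (S : Setup g φ0 η0 α q p) {φ η : ℝ → ℝ} (H : C1P φ η) (k : ℕ) (x : ℝ) (i : ℤ) :
    birkhoffSum g φ k (x + i) = birkhoffSum g φ k x := by
  rw [birkhoffSum, birkhoffSum]
  apply Finset.sum_congr rfl
  intro j _
  rw [iter_add_int S.per, H.perz]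

theorem osc (S : Setup g φ0 η0 α q p) {φ η : ℝ → ℝ} (H : C1P φ η) (n : ℕ) (x z : ℝ) :
    |birkhoffSum g φ (q (n + 1)) z - birkhoffSum g φ (q (n + 1)) x| ≤ 4 * varV η := by
  obtain ⟨k, hk, i, hi⟩ := cover S.mono S.per S.rot (S.good n) x z
  have hcont : Continuous g := continuous_iff_continuousAt.mpr (fun x => (S.der x).continuousAt)
  obtain ⟨t, ht, hte⟩ := intermediate_value_uIcc (hcont.iterate k).continuousOn
    (Set.uIoc_subset_uIcc hi)
  rw [← S.bs_per H _ z i, ← hte]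
  have h1 := S.dist H n ht Set.left_mem_uIcc (k := q (n + 1)) (by omega)
  have h2 : birkhoffSum g φ (q (n + 1)) (g^[k] t) - birkhoffSum g φ (q (n + 1)) t
      = birkhoffSum g φ k (g^[q (n + 1)] t - p (n + 1)) - birkhoffSum g φ k t := by
    have e1 := birkhoffSum_add g φ k (q (n + 1)) t
    have e2 := birkhoffSum_add g φ (q (n + 1)) k t
    have e3 := S.bs_per H k (g^[q (n + 1)] t) (-(p (n + 1)))
    push_cast at e3
    rw [← sub_eq_add_neg] at e3
    rw [add_comm] at e1
    linarith
  have hq := S.qadd n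
  have h3 := S.dist H (n + 1) (Set.right_mem_uIcc (a := t) (b := g^[q (n + 1)] t - p (n + 1)))
    Set.left_mem_uIcc (k := k) (by have : q (n + 1 + 1) = q (n + 2) := rfl; omega)
  rw [← h2] at h3
  rw [abs_le] at *
  constructor <;> linarith [h1.1, h1.2, h3.1, h3.2]

theorem iter_der (S : Setup g φ0 η0 α q p) (k : ℕ) (x : ℝ) :
    HasDerivAt (g^[k]) (Real.exp (birkhoffSum g φ0 k x)) x := by
  induction k with
  | zero => simpa using hasDerivAt_id x
  | succ k ih =>
    rw [Function.iterate_succ', birkhoffSum_succ, add_comm, Real.exp_add]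
    exact (S.der _).comp x ih

theorem contg (S : Setup g φ0 η0 α q p) : Continuous g :=
  continuous_iff_continuousAt.mpr (fun x => (S.der x).continuousAt)

theorem cont_bs (S : Setup g φ0 η0 α q p) {φ : ℝ → ℝ} (hφ : Continuous φ) (k : ℕ) :
    Continuous (birkhoffSum g φ k) := by
  unfold birkhoffSum
  exact continuous_finsetSum _ (fun j _ => hφ.comp (S.contg.iterate j))

theorem slope (S : Setup g φ0 η0 α q p) (k : ℕ) (a b : ℝ) :
    ∃ ξ ∈ Set.uIcc a b, g^[k] b - g^[k] a = Real.exp (birkhoffSum g φ0 k ξ) * (b - a) := by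
  have hc : Continuous (g^[k]) := S.contg.iterate k
  rcases lt_trichotomy a b with h | h | h
  · obtain ⟨c, hc, he⟩ := exists_hasDerivAt_eq_slope _ _ h hc.continuousOn
      (fun x _ => S.iter_der k x)
    refine ⟨c, ?_, ?_⟩
    · rw [Set.uIcc_of_le h.le]; exact Set.Ioo_subset_Icc_self hc
    · rw [he, div_mul_cancel₀ _ (by linarith [h] : b - a ≠ 0)]
  · subst h; exact ⟨a, by simp, by simp⟩
  · obtain ⟨c, hc, he⟩ := exists_hasDerivAt_eq_slope _ _ h hc.continuousOn
      (fun x _ => S.iter_der k x)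
    refine ⟨c, ?_, ?_⟩
    · rw [Set.uIcc_of_ge h.le]; exact Set.Ioo_subset_Icc_self hc
    · have : a - b ≠ 0 := sub_ne_zero.mpr h.ne'
      rw [he]; field_simp; ring

theorem exists_zero (S : Setup g φ0 η0 α q p) (k : ℕ) : ∃ y, birkhoffSum g φ0 k y = 0 := by
  obtain ⟨y, _, h⟩ := S.slope k 0 1
  refine ⟨y, ?_⟩
  have := iter_add_int S.per k 0 1
  simp only [zero_add, Int.cast_one] at this
  rw [this] at h
  apply Real.exp_eq_one_iff _ |>.mp
  linarith

theorem denjoy (S : Setup g φ0 η0 α q p) (n : ℕ) (x : ℝ) :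
    |birkhoffSum g φ0 (q (n + 1)) x| ≤ 4 * varV η0 := by
  obtain ⟨y, hy⟩ := S.exists_zero (q (n + 1))
  have := S.osc S.c1 n y x
  rwa [hy, sub_zero] at this

theorem qmono (S : Setup g φ0 η0 α q p) : StrictMono (fun j => q (j + 1)) := by
  apply strictMono_nat_of_lt_succ
  intro n
  have h1 := S.qadd n
  have h2 := (S.good n).qpos
  show q (n + 1) < q (n + 2)
  omega

theorem small (S : Setup g φ0 η0 α q p) (n : ℕ) (x : ℝ) :
    n * (Real.exp (-(4 * varV η0)) * |g^[q n] x - p n - x|) ≤ 1 := by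
  have h := S.sum_le (h := fun _ => 1) continuous_const (fun _ => zero_le_one) (fun _ => rfl) n x
  simp only [intervalIntegral.integral_const, smul_eq_mul, mul_one, sub_zero] at h
  refine le_trans ?_ h
  have hsub : (Finset.range n).image (fun j => q (j + 1)) ⊆ Finset.range (q (n + 1)) := by
    intro k hk
    simp only [Finset.mem_image, Finset.mem_range] at hk ⊢
    obtain ⟨j, hj, rfl⟩ := hk
    exact S.qmono hj
  refine le_trans ?_ (Finset.sum_le_sum_of_subset_of_nonneg hsub (fun _ _ _ => abs_nonneg _))
  rw [Finset.sum_image (fun a _ b _ hab => S.qmono.injective hab)]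
  have : ∀ j ∈ Finset.range n, Real.exp (-(4 * varV η0)) * |g^[q n] x - p n - x|
      ≤ |g^[q (j + 1)] (g^[q n] x - p n) - g^[q (j + 1)] x| := by
    intro j _
    obtain ⟨ξ, _, he⟩ := S.slope (q (j + 1)) x (g^[q n] x - p n)
    rw [he, abs_mul, Real.abs_exp]
    have := (abs_le.mp (S.denjoy j ξ)).1
    gcongr
  have := Finset.card_nsmul_le_sum _ _ _ this
  simpa using this

theorem small' (S : Setup g φ0 η0 α q p) (ε : ℝ) (hε : 0 < ε) :
    ∃ n₀, ∀ n ≥ n₀, ∀ x, |g^[q n] x - p n - x| < ε := by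
  obtain ⟨N, hN⟩ := exists_nat_gt (1 / (Real.exp (-(4 * varV η0)) * ε))
  refine ⟨N, fun n hn x => ?_⟩
  by_contra hc
  push Not at hc
  have h1 := S.small n x
  have he := Real.exp_pos (-(4 * varV η0))
  rw [div_lt_iff₀ (by positivity)] at hN
  have hn' : (N : ℝ) ≤ n := by exact_mod_cast hn
  have : (N : ℝ) * (Real.exp (-(4 * varV η0)) * ε)
    ≤ n * (Real.exp (-(4 * varV η0)) * |g^[q n] x - p n - x|) := by gcongr
  linarith

theorem lower (S : Setup g φ0 η0 α q p) {h : ℝ → ℝ} (hc : Continuous h) (h0 : ∀ x, 0 ≤ h x)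
    (hp : ∀ x, h (x + 1) = h x) (n : ℕ) (ω δ : ℝ) (hω : 0 ≤ ω)
    (hd : ∀ x, |g^[q n] x - p n - x| < δ) (hu : ∀ s t, |s - t| < δ → |h s - h t| ≤ ω)
    (x y : ℝ) (hy : y ∈ Set.uIcc x (g^[q n] x - p n)) :
    Real.exp (-(2 * varV η0)) * ((∫ t in (0 : ℝ)..1, h t) - 2 * ω) ≤
      |g^[q n] x - p n - x| * ∑ k ∈ Finset.range (q n + q (n + 1)),
        h (g^[k] y) * Real.exp (birkhoffSum g φ0 k y) := by
  have h1 := S.le_sum hc h0 hp n x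
  have h2 := S.sum_le2 (h := fun _ => 1) continuous_const (fun _ => zero_le_one) (fun _ => rfl) n x
  simp only [intervalIntegral.integral_const, smul_eq_mul, mul_one, sub_zero] at h2
  set b := g^[q n] x - p n with hb
  have term : ∀ k ∈ Finset.range (q n + q (n + 1)),
      Real.exp (-(2 * varV η0)) * (|∫ t in g^[k] x..g^[k] b, h t| - ω * |g^[k] b - g^[k] x|)
      ≤ |b - x| * (h (g^[k] y) * Real.exp (birkhoffSum g φ0 k y)) := by
    intro k hk
    rw [Finset.mem_range] at hk
    obtain ⟨ξ, hξ, he⟩ := S.slope k x b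
    have hD := (abs_le.mp (S.dist S.c1 n hξ hy hk.le)).2
    have hlen : |g^[k] b - g^[k] x| < δ := by
      rw [hb, S.comm]; exact hd _
    have hI : |∫ t in g^[k] x..g^[k] b, h t| ≤ (h (g^[k] y) + ω) * |g^[k] b - g^[k] x| := by
      rw [← Real.norm_eq_abs (∫ t in g^[k] x..g^[k] b, h t)]
      apply intervalIntegral.norm_integral_le_of_norm_le_const
      intro t ht
      rw [Real.norm_eq_abs, abs_of_nonneg (h0 t)]
      have : |t - g^[k] y| < δ := lt_of_le_of_lt
        ((Set.abs_sub_le_of_uIcc_subset_uIcc (Set.uIcc_subset_uIcc (S.iter_mem k hy)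
          (Set.uIoc_subset_uIcc ht)))) hlen
      have := (abs_le.mp (hu _ _ this)).2
      linarith
    have hE : Real.exp (-(2 * varV η0)) * |g^[k] b - g^[k] x|
        ≤ |b - x| * Real.exp (birkhoffSum g φ0 k y) := by
      rw [he, abs_mul, Real.abs_exp, ← mul_assoc, ← Real.exp_add, mul_comm]
      gcongr
      linarith
    have e1 := Real.exp_pos (-(2 * varV η0))
    calc _ ≤ Real.exp (-(2 * varV η0)) * (h (g^[k] y) * |g^[k] b - g^[k] x|) := by
          gcongr; linarith
      _ = h (g^[k] y) * (Real.exp (-(2 * varV η0)) * |g^[k] b - g^[k] x|) := by ring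
      _ ≤ h (g^[k] y) * (|b - x| * Real.exp (birkhoffSum g φ0 k y)) := by
          gcongr; exact h0 _
      _ = _ := by ring
  have := Finset.sum_le_sum term
  rw [← Finset.mul_sum, ← Finset.mul_sum, Finset.sum_sub_distrib, ← Finset.mul_sum] at this
  refine le_trans ?_ this
  refine mul_le_mul_of_nonneg_left ?_ (Real.exp_pos _).le
  have := mul_le_mul_of_nonneg_left h2 hω
  linarith

end Setup

theorem per_uc {h : ℝ → ℝ} (hc : Continuous h) (hp : ∀ x, h (x + 1) = h x) (ω : ℝ) (hω : 0 < ω) :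
    ∃ δ > 0, ∀ s t, |s - t| < δ → |h s - h t| ≤ ω := by
  have hp' : ∀ (i : ℤ) x, h (x - i) = h x := by
    intro i x
    have := (show Function.Periodic h 1 from hp).sub_int_mul_eq (x := x) i
    simpa using this
  have hu := (isCompact_Icc (a := (-1 : ℝ)) (b := 2)).uniformContinuousOn_of_continuous
    hc.continuousOn
  rw [Metric.uniformContinuousOn_iff] at hu
  obtain ⟨δ, hδ, H⟩ := hu ω hω
  refine ⟨min δ 1, by positivity, fun s t hst => ?_⟩
  have h1 := Int.floor_le s
  have h2 := Int.lt_floor_add_one s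
  rw [lt_min_iff] at hst
  have h3 := abs_lt.mp hst.2
  have := H (s - ⌊s⌋) ⟨by linarith, by linarith⟩ (t - ⌊s⌋) ⟨by linarith, by linarith⟩ (by
    rw [Real.dist_eq, sub_sub_sub_cancel_right]; exact hst.1)
  rw [hp', hp', Real.dist_eq] at this
  exact this.le

theorem abs_int_ge {W : ℝ → ℝ} (hc : Continuous W) {m a b : ℝ}
    (h : ∀ t ∈ Set.uIcc a b, m ≤ W t) : m * |b - a| ≤ |∫ t in a..b, W t| := by
  rcases le_total a b with hab | hab
  · rw [Set.uIcc_of_le hab] at h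
    have := intervalIntegral.integral_mono_on (μ := MeasureTheory.volume) hab (f := fun _ => m) (g := W)
      (continuous_const.intervalIntegrable _ _)
      (hc.intervalIntegrable _ _) h
    rw [intervalIntegral.integral_const, smul_eq_mul] at this
    rw [abs_of_nonneg (sub_nonneg.mpr hab), mul_comm]
    exact this.trans (le_abs_self _)
  · rw [Set.uIcc_of_ge hab] at h
    have := intervalIntegral.integral_mono_on (μ := MeasureTheory.volume) hab (f := fun _ => m) (g := W)
      (continuous_const.intervalIntegrable _ _)
      (hc.intervalIntegrable _ _) h
    rw [intervalIntegral.integral_const, smul_eq_mul] at this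
    rw [intervalIntegral.integral_symm, abs_neg, abs_sub_comm,
      abs_of_nonneg (sub_nonneg.mpr hab), mul_comm]
    exact this.trans (le_abs_self _)

namespace Setup
variable {g φ0 η0 : ℝ → ℝ} {α : ℝ} {q : ℕ → ℕ} {p : ℕ → ℤ}

theorem cont0 (S : Setup g φ0 η0 α q p) : Continuous φ0 :=
  continuous_iff_continuousAt.mpr (fun x => (S.c1.der x).continuousAt)

theorem gn_ne (S : Setup g φ0 η0 α q p) (n : ℕ) (x : ℝ) : 0 < |g^[q n] x - p n - x| := by
  rw [abs_pos]
  have hd0 : (q n : ℝ) * α - p n ≠ 0 := fun h => by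
    have := (S.good n).opp; rw [h] at this; simp at this
  rcases lt_or_gt_of_ne hd0 with hd | hd
  · have := rot_neg S.mono S.per S.rot (q n) (-(p n)) (by push_cast; linarith) x
    push_cast at this
    intro h; linarith
  · have := rot_pos S.mono S.per S.rot (q n) (-(p n)) (by push_cast; linarith) x
    push_cast at this
    intro h; linarith

/-- the transfer sums -/
noncomputable def tr (g φ0 : ℝ → ℝ) (N : ℕ) (h : ℝ → ℝ) (y : ℝ) : ℝ :=
  ∑ k ∈ Finset.range N, h (g^[k] y) * Real.exp (birkhoffSum g φ0 k y)

theorem tr_cont (S : Setup g φ0 η0 α q p) (N : ℕ) {h : ℝ → ℝ} (hc : Continuous h) :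
    Continuous (tr g φ0 N h) := by
  unfold tr
  exact continuous_finsetSum _ (fun j _ => (hc.comp (S.contg.iterate j)).mul
    (S.cont_bs S.cont0 j).rexp)

theorem tr_per (S : Setup g φ0 η0 α q p) (N : ℕ) {h : ℝ → ℝ} (hp : ∀ x, h (x + 1) = h x) (x : ℝ) :
    tr g φ0 N h (x + 1) = tr g φ0 N h x := by
  unfold tr
  apply Finset.sum_congr rfl
  intro k _
  have h1 := iter_add_int S.per k x 1
  have h2 := S.bs_per S.c1 k x 1
  rw [Int.cast_one] at h1 h2
  rw [h1, h2, hp]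

theorem tr_int (S : Setup g φ0 η0 α q p) (N : ℕ) {h : ℝ → ℝ} (hc : Continuous h)
    (hp : ∀ x, h (x + 1) = h x) :
    ∫ y in (0 : ℝ)..1, tr g φ0 N h y = N * ∫ y in (0 : ℝ)..1, h y := by
  unfold tr
  rw [intervalIntegral.integral_finsetSum]
  · have : ∀ k ∈ Finset.range N, ∫ y in (0 : ℝ)..1,
        h (g^[k] y) * Real.exp (birkhoffSum g φ0 k y) = ∫ y in (0 : ℝ)..1, h y := by
      intro k _
      have e := intervalIntegral.integral_comp_mul_deriv (a := 0) (b := 1) (f := g^[k])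
        (f' := fun y => Real.exp (birkhoffSum g φ0 k y)) (g := h)
        (fun x _ => S.iter_der k x) (S.cont_bs S.cont0 k).rexp.continuousOn hc
      simp only [Function.comp] at e
      rw [e]
      have h1 := iter_add_int S.per k 0 1
      simp only [zero_add, Int.cast_one] at h1
      rw [h1, (show Function.Periodic h 1 from hp).intervalIntegral_add_eq (g^[k] 0) 0, zero_add]
    rw [Finset.sum_congr rfl this]
    simp
  · intro k _
    exact ((hc.comp (S.contg.iterate k)).mul
      (S.cont_bs S.cont0 k).rexp).intervalIntegrable _ _

theorem contr (S : Setup g φ0 η0 α q p) {φ η : ℝ → ℝ} (H : C1P φ η) :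
    ∃ φ' η' ψ : ℝ → ℝ, C1P φ' η' ∧ Continuous ψ ∧ (∀ x, ψ (x + 1) = ψ x) ∧
      (∀ x, φ' x = φ x + ψ (g x) - ψ x) ∧
      varV η' ≤ (1 - Real.exp (-(2 * varV η0)) / 4) * varV η := by
  rcases (varV_nonneg η).eq_or_lt with hV | hV
  · refine ⟨φ, η, fun _ => 0, H, continuous_const, fun _ => rfl, fun _ => by simp, ?_⟩
    rw [← hV]; simp
  set V := varV η with hVdef
  set c := Real.exp (-(2 * varV η0)) with hcdef
  have hcpos : 0 < c := Real.exp_pos _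
  have hφc : Continuous φ := continuous_iff_continuousAt.mpr (fun x => (H.der x).continuousAt)
  -- positive and negative parts
  have hpc : Continuous (fun t => max (η t) 0) := H.cont.max continuous_const
  have hmc : Continuous (fun t => max (-η t) 0) := H.cont.neg.max continuous_const
  have i0 : ∫ t in (0 : ℝ)..1, η t = 0 := by
    rw [intervalIntegral.integral_eq_sub_of_hasDerivAt (fun x _ => H.der x)
      (H.cont.intervalIntegrable _ _)]
    have := H.per 0
    rw [zero_add] at this
    rw [this, sub_self]
  have pe : ∀ t, max (η t) 0 = (|η t| + η t) / 2 := by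
    intro t
    rcases le_total (η t) 0 with h | h
    · rw [max_eq_right h, abs_of_nonpos h]; ring
    · rw [max_eq_left h, abs_of_nonneg h]; ring
  have me : ∀ t, max (-η t) 0 = (|η t| - η t) / 2 := by
    intro t
    rcases le_total (η t) 0 with h | h
    · rw [max_eq_left (by linarith), abs_of_nonpos h]; ring
    · rw [max_eq_right (by linarith), abs_of_nonneg h]; ring
  have ip : ∫ t in (0 : ℝ)..1, max (η t) 0 = V / 2 := by
    simp_rw [pe]
    rw [intervalIntegral.integral_div, intervalIntegral.integral_add
      (H.cont.abs.intervalIntegrable _ _) (H.cont.intervalIntegrable _ _), i0, add_zero]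
    rfl
  have im : ∫ t in (0 : ℝ)..1, max (-η t) 0 = V / 2 := by
    simp_rw [me]
    rw [intervalIntegral.integral_div, intervalIntegral.integral_sub
      (H.cont.abs.intervalIntegrable _ _) (H.cont.intervalIntegrable _ _), i0, sub_zero]
    rfl
  obtain ⟨δ, hδ, hu⟩ := per_uc H.cont H.per' (V / 8) (by positivity)
  obtain ⟨n, hn⟩ := S.small' δ hδ
  have hd := hn n le_rfl
  set N := q n + q (n + 1) with hN
  have hNpos : 0 < N := by have := (S.good n).qpos; omega
  have hNR : (0 : ℝ) < N := by exact_mod_cast hNpos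
  set P := tr g φ0 N (fun t => max (η t) 0) with hP
  set Q := tr g φ0 N (fun t => max (-η t) 0) with hQ
  have hPc : Continuous P := S.tr_cont N hpc
  have hQc : Continuous Q := S.tr_cont N hmc
  have hPp : ∀ x, P (x + 1) = P x := S.tr_per N (fun x => by rw [H.per'])
  have hQp : ∀ x, Q (x + 1) = Q x := S.tr_per N (fun x => by rw [H.per'])
  have hP0 : ∀ x, 0 ≤ P x := fun x => Finset.sum_nonneg (fun k _ =>
    mul_nonneg (le_max_right _ _) (Real.exp_pos _).le)
  have hQ0 : ∀ x, 0 ≤ Q x := fun x => Finset.sum_nonneg (fun k _ =>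
    mul_nonneg (le_max_right _ _) (Real.exp_pos _).le)
  have hPQ : ∀ x, P x - Q x = tr g φ0 N η x := by
    intro x
    simp only [hP, hQ, tr]
    rw [← Finset.sum_sub_distrib]
    apply Finset.sum_congr rfl
    intro k _
    rw [pe, me]; ring
  have hW : Continuous (fun t => min (P t) (Q t)) := hPc.min hQc
  -- lower bound on one interval
  have hJ : ∀ x, c * (V / 4) ≤ |∫ t in x..(g^[q n] x - p n), min (P t) (Q t)| := by
    intro x
    have hl := S.gn_ne n x
    have := abs_int_ge hW (m := c * (V / 4) / |g^[q n] x - p n - x|) (a := x)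
      (b := g^[q n] x - p n) (by
      intro t ht
      rw [div_le_iff₀' hl, mul_min_of_nonneg _ _ hl.le]
      apply le_min
      · have := S.lower hpc (fun _ => le_max_right _ _) (fun x => by rw [H.per']) n (V / 8) δ
          (by positivity) hd (fun s t hst => (abs_max_sub_max_le_abs _ _ _).trans (hu s t hst)) x t ht
        rw [ip] at this
        refine le_trans (le_of_eq ?_) this
        ring
      · have := S.lower hmc (fun _ => le_max_right _ _) (fun x => by rw [H.per']) n (V / 8) δ
          (by positivity) hd (fun s t hst => (abs_max_sub_max_le_abs _ _ _).trans (by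
            have := hu s t hst
            rwa [neg_sub_neg, abs_sub_comm])) x t ht
        rw [im] at this
        refine le_trans (le_of_eq ?_) this
        ring)
    rwa [div_mul_cancel₀ _ hl.ne'] at this
  have hWint : q (n + 1) * (c * (V / 4)) ≤ ∫ t in (0 : ℝ)..1, min (P t) (Q t) := by
    have h1 := S.sum_le hW (fun x => le_min (hP0 x) (hQ0 x)) (fun x => by rw [hPp, hQp]) n 0
    refine le_trans ?_ h1
    have : ∀ k ∈ Finset.range (q (n + 1)), c * (V / 4) ≤
        |∫ t in g^[k] 0..g^[k] (g^[q n] 0 - p n), min (P t) (Q t)| := by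
      intro k _
      rw [S.comm]
      exact hJ _
    have := Finset.card_nsmul_le_sum _ _ _ this
    simpa using this
  have hPi : ∫ t in (0 : ℝ)..1, P t = N * (V / 2) := by
    rw [← ip]; exact S.tr_int N hpc (fun x => by rw [H.per'])
  have hQi : ∫ t in (0 : ℝ)..1, Q t = N * (V / 2) := by
    rw [← im]; exact S.tr_int N hmc (fun x => by rw [H.per'])
  have habs : ∫ t in (0 : ℝ)..1, |tr g φ0 N η t| =
      N * V - 2 * ∫ t in (0 : ℝ)..1, min (P t) (Q t) := by
    have : ∀ t, |tr g φ0 N η t| = P t + Q t - 2 * min (P t) (Q t) := by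
      intro t
      rw [← hPQ]
      rcases le_total (P t) (Q t) with h | h
      · rw [min_eq_left h, abs_of_nonpos (by linarith)]; ring
      · rw [min_eq_right h, abs_of_nonneg (by linarith)]; ring
    simp_rw [this]
    rw [intervalIntegral.integral_sub
      ((show Continuous (fun t => P t + Q t) from hPc.add hQc).intervalIntegrable _ _)
      ((hW.const_mul 2).intervalIntegrable _ _), intervalIntegral.integral_add
      (hPc.intervalIntegrable _ _) (hQc.intervalIntegrable _ _),
      intervalIntegral.integral_const_mul, hPi, hQi]
    ring
  refine ⟨fun x => (∑ k ∈ Finset.range N, φ (g^[k] x)) / N, fun x => tr g φ0 N η x / N,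
    fun x => (∑ k ∈ Finset.range N, birkhoffSum g φ k x) / N, ⟨?_, ?_, ?_, ?_⟩, ?_, ?_, ?_, ?_⟩
  · intro x
    apply HasDerivAt.div_const
    unfold tr
    apply HasDerivAt.fun_sum
    intro k _
    exact (H.der _).comp x (S.iter_der k x)
  · exact (S.tr_cont N H.cont).div_const _
  · intro x
    show (_ : ℝ) / _ = _ / _
    congr 1
    apply Finset.sum_congr rfl
    intro k _
    have h1 := iter_add_int S.per k x 1
    rw [Int.cast_one] at h1
    rw [h1, H.per]
  · intro x; simp only [S.tr_per N H.per']
  · exact (continuous_finsetSum _ (fun k _ => S.cont_bs hφc k)).div_const _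
  · intro x
    show (_ : ℝ) / _ = _ / _
    congr 1
    apply Finset.sum_congr rfl
    intro k _
    have h1 := S.bs_per H k x 1
    rwa [Int.cast_one] at h1
  · intro x
    have : ∑ k ∈ Finset.range N, birkhoffSum g φ k (g x) - ∑ k ∈ Finset.range N, birkhoffSum g φ k x
        = ∑ k ∈ Finset.range N, φ (g^[k] x) - N * φ x := by
      rw [← Finset.sum_sub_distrib]
      simp_rw [birkhoffSum_apply_sub_birkhoffSum]
      rw [Finset.sum_sub_distrib]
      simp
    field_simp
    linarith
  · have : varV (fun x => tr g φ0 N η x / N) = (∫ t in (0 : ℝ)..1, |tr g φ0 N η t|) / N := by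
      unfold varV
      simp_rw [abs_div, Nat.abs_cast]
      rw [intervalIntegral.integral_div]
    rw [this, habs, div_le_iff₀ hNR]
    have h2 : (N : ℝ) ≤ 2 * q (n + 1) := by
      have := (S.good n).qle
      have : N ≤ 2 * q (n + 1) := by omega
      exact_mod_cast this
    have h3 : (N : ℝ) * (c * (V / 4)) ≤ 2 * q (n + 1) * (c * (V / 4)) := by gcongr
    nlinarith

theorem contr_iter (S : Setup g φ0 η0 α q p) (m : ℕ) :
    ∃ φ' η' ψ : ℝ → ℝ, C1P φ' η' ∧ Continuous ψ ∧ (∀ x, ψ (x + 1) = ψ x) ∧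
      (∀ x, φ' x = φ0 x + ψ (g x) - ψ x) ∧
      varV η' ≤ (1 - Real.exp (-(2 * varV η0)) / 4) ^ m * varV η0 := by
  induction m with
  | zero => exact ⟨φ0, η0, fun _ => 0, S.c1, continuous_const, fun _ => rfl, fun _ => by simp,
      by simp⟩
  | succ m ih =>
    obtain ⟨φ', η', ψ, H, hψ, hψp, he, hV⟩ := ih
    obtain ⟨φ'', η'', ψ', H', hψ', hψp', he', hV'⟩ := S.contr H
    refine ⟨φ'', η'', fun x => ψ x + ψ' x, H', hψ.add hψ', fun x => by simp only [hψp, hψp'],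
      fun x => by rw [he', he]; ring, ?_⟩
    refine hV'.trans ?_
    rw [pow_succ', mul_assoc]
    refine mul_le_mul_of_nonneg_left hV ?_
    have : Real.exp (-(2 * varV η0)) ≤ 1 := Real.exp_le_one_iff.mpr (by
      linarith [varV_nonneg η0])
    linarith

theorem herman (S : Setup g φ0 η0 α q p) (ε : ℝ) (hε : 0 < ε) :
    ∃ n₀, ∀ n ≥ n₀, ∀ x, |birkhoffSum g φ0 (q n) x| ≤ ε := by
  have hc := Real.exp_pos (-(2 * varV η0))
  have hc1 : Real.exp (-(2 * varV η0)) ≤ 1 := Real.exp_le_one_iff.mpr (by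
      linarith [varV_nonneg η0])
  obtain ⟨m, hm⟩ := exists_pow_lt_of_lt_one (x := ε / 8 / (varV η0 + 1))
    (y := 1 - Real.exp (-(2 * varV η0)) / 4)
    (by have := varV_nonneg η0; positivity) (by linarith)
  obtain ⟨φ, η, ψ, H, hψ, hψp, he, hV⟩ := S.contr_iter m
  have hV2 : varV η ≤ ε / 8 := by
    refine hV.trans ?_
    have h0 := varV_nonneg η0
    rw [lt_div_iff₀ (by positivity)] at hm
    have : 0 ≤ (1 - Real.exp (-(2 * varV η0)) / 4) ^ m := pow_nonneg (by linarith) _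
    nlinarith
  obtain ⟨δ, hδ, hu⟩ := per_uc hψ hψp (ε / 4) (by positivity)
  obtain ⟨n₀, hn₀⟩ := S.small' δ hδ
  refine ⟨n₀ + 1, fun n hn x => ?_⟩
  obtain ⟨n, rfl⟩ : ∃ k, n = k + 1 := ⟨n - 1, by omega⟩
  have key : ∀ x, |birkhoffSum g φ (q (n + 1)) x - birkhoffSum g φ0 (q (n + 1)) x| ≤ ε / 4 := by
    intro x
    have e : ∀ k, birkhoffSum g φ k x - birkhoffSum g φ0 k x = ψ (g^[k] x) - ψ x := by
      intro k
      induction k with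
      | zero => simp
      | succ k ih =>
        rw [birkhoffSum_succ, birkhoffSum_succ, he, Function.iterate_succ_apply']
        linarith
    rw [e]
    have : ψ (g^[q (n + 1)] x) = ψ (g^[q (n + 1)] x - p (n + 1)) := by
      have := (show Function.Periodic ψ 1 from hψp).sub_int_mul_eq (x := g^[q (n + 1)] x) (p (n + 1))
      rw [mul_one] at this
      exact this.symm
    rw [this]
    exact hu _ _ (hn₀ _ (by omega) x)
  obtain ⟨y, hy⟩ := S.exists_zero (q (n + 1))
  have h1 := abs_le.mp (key x)
  have h2 := abs_le.mp (key y)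
  have h3 := abs_le.mp (S.osc H n y x)
  rw [hy] at h2
  rw [abs_le]
  constructor <;> linarith [h1.1, h1.2, h2.1, h2.2, h3.1, h3.2]

end Setup
/-- **Almost-constancy of `mₙ` on the intervals `Iₙ(x)`.**
Let `g` be the lift of an orientation-preserving `C³` circle diffeomorphism with irrational
rotation number `α`, and `mₙ(x) = gₙ(x) − x` with `gₙ(x) = g^{qₙ}(x) − pₙ`.  For every `ε > 0`
there is `n₀ ≥ 1` such that for all `n ≥ n₀`, all `x` and all `y ∈ Iₙ(x)`,
`1 − ε ≤ mₙ(y)/mₙ(x) ≤ 1 + ε`. -/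
theorem ratio_mn_close_to_one
    (g : ℝ → ℝ) (hg : ContDiff ℝ 3 g) (hgmono : StrictMono g)
    (hgsurj : Function.Surjective g) (hgder : ∀ x, 0 < deriv g x)
    (hgper : ∀ x, g (x + 1) = g x + 1)
    (α : ℝ) (hα : Irrational α)
    (hrot : ∀ x : ℝ, Tendsto (fun m : ℕ => (g^[m] x - x) / m) atTop (𝓝 α)) :
    ∀ ε > (0 : ℝ), ∃ n₀ : ℕ, 1 ≤ n₀ ∧ ∀ n ≥ n₀, ∀ x : ℝ,
      ∀ y ∈ Set.uIcc x (cfIter g α n x),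
        1 - ε ≤ (cfIter g α n y - y) / (cfIter g α n x - x) ∧
        (cfIter g α n y - y) / (cfIter g α n x - x) ≤ 1 + ε := by
  have hd1 : ContDiff ℝ 2 (deriv g) := by
    have : ContDiff ℝ (2 + 1) g := by norm_num; exact hg
    exact (contDiff_succ_iff_deriv.mp this).2.2
  have hgd : Differentiable ℝ g := hg.differentiable (by norm_num)
  have hd1d : Differentiable ℝ (deriv g) := hd1.differentiable (by norm_num)
  have hd2c : Continuous (deriv (deriv g)) := hd1.continuous_deriv (by norm_num)
  have per1 : ∀ x, deriv g (x + 1) = deriv g x := by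
    intro x
    rw [← deriv_comp_add_const, funext hgper, deriv_add_const]
  have per2 : ∀ x, deriv (deriv g) (x + 1) = deriv (deriv g) x := by
    intro x
    rw [← deriv_comp_add_const, funext per1]
  have S : Setup g (fun x => Real.log (deriv g x)) (fun x => deriv (deriv g) x / deriv g x) α
      (cfQ α) (cfP α) := by
    refine ⟨hgmono, hgper, hα, hrot, cf_good hα, cf_q_add hα, ?_, ⟨?_, ?_, ?_, ?_⟩⟩
    · intro x
      rw [Real.exp_log (hgder x)]
      exact (hgd x).hasDerivAt
    · intro x
      exact (hd1d x).hasDerivAt.log (hgder x).ne'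
    · exact hd2c.div hd1d.continuous (fun x => (hgder x).ne')
    · intro x; simp only [per1]
    · intro x; simp only [per1, per2]
  intro ε hε
  obtain ⟨n₀, hn₀⟩ := S.herman (min (ε / 2) 1) (by positivity)
  refine ⟨n₀ + 1, by omega, fun n hn x y hy => ?_⟩
  have hb := hn₀ n (by omega)
  have hne := S.gn_ne n x
  have hne' : cfIter g α n x - x ≠ 0 := by
    intro h; unfold cfIter at h; rw [h] at hne; simp at hne
  obtain ⟨ξ, _, hs⟩ := S.slope (cfQ α n) x y
  set u := birkhoffSum g (fun x => Real.log (deriv g x)) (cfQ α n) ξ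
  have hu := hb ξ
  have hu1 : |u| ≤ 1 := hu.trans (min_le_right _ _)
  have hu2 : |u| ≤ ε / 2 := hu.trans (min_le_left _ _)
  have hexp : |Real.exp u - 1| ≤ ε := by
    have := Real.abs_exp_sub_one_le hu1
    linarith
  have hdiff : (cfIter g α n y - y) - (cfIter g α n x - x) = (Real.exp u - 1) * (y - x) := by
    unfold cfIter
    linarith
  have hyx : |y - x| ≤ |cfIter g α n x - x| := Set.abs_sub_left_of_mem_uIcc hy
  have hr : |(cfIter g α n y - y) / (cfIter g α n x - x) - 1| ≤ ε := by
    rw [div_sub_one hne', hdiff, abs_div, abs_mul, div_le_iff₀ (abs_pos.mpr hne')]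
    exact mul_le_mul hexp hyx (abs_nonneg _) hε.le
  have := abs_le.mp hr
  constructor <;> linarith [this.1, this.2]
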